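/- Let φ : ℝ × ℝ → ℝ be smooth with φ_x nowhere zero and satisfying the KdV singularity manifold equation φ_t = φ_x {φ; x} at every point, where {φ; x} = (φ_xx/φ_x)_x − (1/2)(φ_xx/φ_x)². Let w : ℝ × ℝ → ℝ be smooth, nowhere zero, with w² = φ_x at every point. Then w satisfies the KdV eigenfunction equation w_t = w_xxx − 3 w_x w_xx / w at every point. -/

import Mathlib

/-- Partial derivative with respect to the first (space) variable. -/
noncomputable def px (f : ℝ × ℝ → ℝ) : ℝ × ℝ → ℝ :=
  fun p => deriv (fun x => f (x, p.2)) p.1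

/-- Partial derivative with respect to the second (time) variable. -/
noncomputable def pt (f : ℝ × ℝ → ℝ) : ℝ × ℝ → ℝ :=
  fun p => deriv (fun t => f (p.1, t)) p.2

/-- Schwarzian derivative of `f` with respect to the space variable:
`{f; x} = (f_xx / f_x)_x - (1/2) (f_xx / f_x)²`. -/
noncomputable def schwarz (f : ℝ × ℝ → ℝ) : ℝ × ℝ → ℝ :=
  fun p => px (fun q => px (px f) q / px f q) p - (1/2) * (px (px f) p / px f p) ^ 2

theorem px_eq_fderiv {f : ℝ × ℝ → ℝ} (hf : ContDiff ℝ (⊤ : ℕ∞) f) :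
    px f = fun p => fderiv ℝ f p (1, 0) := by
  funext p
  have hfp : HasFDerivAt f (fderiv ℝ f p) (p.1, p.2) :=
    (hf.differentiable (by simp) p).hasFDerivAt
  exact (hfp.comp_hasDerivAt p.1
    ((hasDerivAt_id p.1).prodMk (hasDerivAt_const p.1 p.2))).deriv

theorem pt_eq_fderiv {f : ℝ × ℝ → ℝ} (hf : ContDiff ℝ (⊤ : ℕ∞) f) :
    pt f = fun p => fderiv ℝ f p (0, 1) := by
  funext p
  have hfp : HasFDerivAt f (fderiv ℝ f p) (p.1, p.2) :=
    (hf.differentiable (by simp) p).hasFDerivAt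
  exact (hfp.comp_hasDerivAt p.2
    ((hasDerivAt_const p.2 p.1).prodMk (hasDerivAt_id p.2))).deriv

theorem contDiff_fderiv_apply_const {f : ℝ × ℝ → ℝ} (hf : ContDiff ℝ (⊤ : ℕ∞) f) (v : ℝ × ℝ) :
    ContDiff ℝ (⊤ : ℕ∞) fun p => fderiv ℝ f p v :=
  (hf.fderiv_right (by simp)).clm_apply contDiff_const

theorem contDiff_px {f : ℝ × ℝ → ℝ} (hf : ContDiff ℝ (⊤ : ℕ∞) f) :
    ContDiff ℝ (⊤ : ℕ∞) (px f) :=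
  px_eq_fderiv hf ▸ contDiff_fderiv_apply_const hf _

theorem contDiff_pt {f : ℝ × ℝ → ℝ} (hf : ContDiff ℝ (⊤ : ℕ∞) f) :
    ContDiff ℝ (⊤ : ℕ∞) (pt f) :=
  pt_eq_fderiv hf ▸ contDiff_fderiv_apply_const hf _

theorem px_pt_comm {f : ℝ × ℝ → ℝ} (hf : ContDiff ℝ (⊤ : ℕ∞) f) (p : ℝ × ℝ) :
    px (pt f) p = pt (px f) p := by
  have hd : DifferentiableAt ℝ (fderiv ℝ f) p :=
    (hf.fderiv_right (m := (⊤ : ℕ∞)) (by simp)).differentiable (by simp) p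
  have hs : IsSymmSndFDerivAt ℝ f p :=
    (hf.of_le (m := 2) (by exact WithTop.coe_le_coe.2 (le_top : (2 : ℕ∞) ≤ ⊤))).contDiffAt.isSymmSndFDerivAt (by simp)
  rw [px_eq_fderiv (contDiff_pt hf), pt_eq_fderiv (contDiff_px hf), pt_eq_fderiv hf,
    px_eq_fderiv hf]
  simp only [fderiv_clm_apply hd (differentiableAt_const _)]
  simpa using hs.eq (1, 0) (0, 1)

theorem hasDerivAt_px {f : ℝ × ℝ → ℝ} (hf : ContDiff ℝ (⊤ : ℕ∞) f) (p : ℝ × ℝ) :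
    HasDerivAt (fun x => f (x, p.2)) (px f p) p.1 :=
  ((hf.differentiable (by simp)).comp
    (differentiable_id.prodMk (differentiable_const p.2)) p.1).hasDerivAt

theorem hasDerivAt_pt {f : ℝ × ℝ → ℝ} (hf : ContDiff ℝ (⊤ : ℕ∞) f) (p : ℝ × ℝ) :
    HasDerivAt (fun t => f (p.1, t)) (pt f p) p.2 :=
  ((hf.differentiable (by simp)).comp
    ((differentiable_const p.1).prodMk differentiable_id) p.2).hasDerivAt

theorem px_sq {w : ℝ × ℝ → ℝ} (hw : ContDiff ℝ (⊤ : ℕ∞) w) (p : ℝ × ℝ) :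
    px (fun q => w q ^ 2) p = 2 * w p * px w p := by
  exact ((hasDerivAt_px hw p).pow 2).deriv.trans (by simp)

theorem pt_sq {w : ℝ × ℝ → ℝ} (hw : ContDiff ℝ (⊤ : ℕ∞) w) (p : ℝ × ℝ) :
    pt (fun q => w q ^ 2) p = 2 * w p * pt w p := by
  exact ((hasDerivAt_pt hw p).pow 2).deriv.trans (by simp)

/-- If `f_x = w²`, then `f_x {f; x} = 2 w w_xx - 4 w_x²`. -/
theorem px_mul_schwarz_of_px_eq_sq {f w : ℝ × ℝ → ℝ} (hw : ContDiff ℝ (⊤ : ℕ∞) w)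
    (hw0 : ∀ p, w p ≠ 0) (hf : px f = fun p => w p ^ 2) (p : ℝ × ℝ) :
    px f p * schwarz f p = 2 * w p * px (px w) p - 4 * px w p ^ 2 := by
  have hlog : (fun q => px (px f) q / px f q) = fun q => 2 * (px w q / w q) := by
    funext q
    have := hw0 q
    rw [hf, px_sq hw]
    field_simp
  have hquot : px (fun q => 2 * (px w q / w q)) p =
      2 * ((px (px w) p * w p - px w p * px w p) / w p ^ 2) :=
    (((hasDerivAt_px (contDiff_px hw) p).div (hasDerivAt_px hw p) (hw0 p)).const_mul 2).deriv
  have hp := hw0 p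
  rw [schwarz, hlog, hquot, congrFun hlog p, hf]
  field_simp
  ring

/-- If `φ` is smooth with `φ_x` nowhere zero and satisfies the KdV singularity manifold
equation `φ_t = φ_x {φ; x}`, and `w` is smooth, nowhere zero, with `w² = φ_x`, then `w`
satisfies the KdV eigenfunction equation `w_t = w_xxx - 3 w_x w_xx / w`. -/
theorem kdvSing_to_kdvEigenfunction
    (φ : ℝ × ℝ → ℝ) (hφ : ContDiff ℝ (⊤ : ℕ∞) φ) (hφx : ∀ p, px φ p ≠ 0)
    (hsing : ∀ p, pt φ p = px φ p * schwarz φ p)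
    (w : ℝ × ℝ → ℝ) (hw : ContDiff ℝ (⊤ : ℕ∞) w) (hw0 : ∀ p, w p ≠ 0)
    (hB : ∀ p, (w p) ^ 2 = px φ p) :
    ∀ p, pt w p = px (px (px w)) p - 3 * px w p * px (px w) p / w p := by
  intro p
  have hφw : px φ = fun q => w q ^ 2 := funext fun q => (hB q).symm
  have hφt : pt φ = fun q => 2 * w q * px (px w) q - 4 * px w q ^ 2 :=
    funext fun q => (hsing q).trans (px_mul_schwarz_of_px_eq_sq hw hw0 hφw q)
  have hw1 := hasDerivAt_px (contDiff_px hw) p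
  have hw2 := hasDerivAt_px (contDiff_px (contDiff_px hw)) p
  have hderiv := ((((hasDerivAt_px hw p).const_mul 2).mul hw2).sub ((hw1.pow 2).const_mul 4)).deriv
  have hcomm := px_pt_comm hφ p
  rw [hφw, pt_sq hw, hφt] at hcomm
  have hkey := hcomm.symm.trans hderiv
  have hp := hw0 p
  have h2 : (2 : ℝ) * w p ≠ 0 := mul_ne_zero two_ne_zero hp
  apply mul_left_cancel₀ h2
  rw [hkey]
  field_simp
  norm_num
  ring
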